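/- arXiv:cs/0307057 — 2 statements merged into one kernel-verified Lean document; each statement's English description precedes it below -/
import Mathlib

section
/- Let R be a system with a probability assignment for agent i such that μ_{r,m,i}(K_i(r,m)) = 1 for every point (r,m), and assume that only countably many distinct local states of agent j occur at points of R (so there are countably many j-information sets; hence for any j-local set S, each S ∩ K_i(r,m) is a countable disjoint union of measurable sets K_j(r'',m'') ∩ K_i(r,m) and so is measurable). Then agent j maintains probabilistic total secrecy with respect to i if and only if for every j-local set S of points there exists a constant σ ∈ [0,1] such that μ_{r,m,i}(S ∩ K_i(r,m)) = σ for every point (r,m). (This is the semantic form of: for every interpretation and every j-local formula φ there is a constant σ with Pr_i(φ) = σ valid.) -/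
open MeasureTheory
open scoped ENNReal

namespace Paper

variable {G LI LJ : Type*}

/-- The set of points of the system `R`: pairs of a run in `R` and a time. -/
def ptsOf (R : Set (ℕ → G)) : Set ((ℕ → G) × ℕ) := {p | p.1 ∈ R}

/-- The information set, at the point `p`, of the agent whose local-state projection is `v`. -/
def infoSet {L : Type*} (R : Set (ℕ → G)) (v : (ℕ → G) → ℕ → L) (p : (ℕ → G) × ℕ) :
    Set ((ℕ → G) × ℕ) :=
  {q | q.1 ∈ R ∧ v q.1 q.2 = v p.1 p.2}

/-- A set `S` of points is local for the agent with local-state projection `v`. -/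
def IsLocalSet {L : Type*} (R : Set (ℕ → G)) (v : (ℕ → G) → ℕ → L)
    (S : Set ((ℕ → G) × ℕ)) : Prop :=
  S ⊆ ptsOf R ∧ ∀ p q : (ℕ → G) × ℕ, p ∈ ptsOf R → q ∈ ptsOf R →
    v p.1 p.2 = v q.1 q.2 → (p ∈ S ↔ q ∈ S)

/-- The points of `R` at which the local state of the agent is `s`. -/
def statePts {L : Type*} (R : Set (ℕ → G)) (v : (ℕ → G) → ℕ → L) (s : L) :
    Set ((ℕ → G) × ℕ) :=
  {q | q.1 ∈ R ∧ v q.1 q.2 = s}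

theorem isLocalSet_infoSet {L : Type*} (R : Set (ℕ → G)) (v : (ℕ → G) → ℕ → L)
    (p : (ℕ → G) × ℕ) : IsLocalSet R v (infoSet R v p) := by
  refine ⟨fun q hq => hq.1, fun q q' hq hq' h => ?_⟩
  exact ⟨fun hp => ⟨hq', h.symm.trans hp.2⟩, fun hp => ⟨hq, h.trans hp.2⟩⟩

/-- A local set is the union of the information sets of the local states it realizes. -/
theorem IsLocalSet.eq_biUnion {L : Type*} {R : Set (ℕ → G)} {v : (ℕ → G) → ℕ → L}
    {S : Set ((ℕ → G) × ℕ)} (hS : IsLocalSet R v S) :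
    S = ⋃ s ∈ (fun q : (ℕ → G) × ℕ => v q.1 q.2) '' S, statePts R v s := by
  ext q
  simp only [Set.mem_iUnion, exists_prop, Set.exists_mem_image]
  constructor
  · exact fun hq => ⟨q, hq, hS.1 hq, rfl⟩
  · rintro ⟨q', hq', hqR, h⟩
    exact (hS.2 q q' hqR (hS.1 hq') h).2 hq'

/-- The measure of a local set inside `K` is the sum over the local states it realizes. -/
theorem IsLocalSet.measure_inter_eq_tsum {L : Type*} {R : Set (ℕ → G)}
    {v : (ℕ → G) → ℕ → L} {S : Set ((ℕ → G) × ℕ)} (hS : IsLocalSet R v S)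
    (hcount : {s : L | ∃ p ∈ ptsOf R, v p.1 p.2 = s}.Countable)
    {m : MeasurableSpace ((ℕ → G) × ℕ)} (μ : Measure ((ℕ → G) × ℕ)) (K : Set ((ℕ → G) × ℕ))
    (hmeas : ∀ q ∈ ptsOf R, MeasurableSet (infoSet R v q ∩ K)) :
    μ (S ∩ K) = ∑' s : (fun q : (ℕ → G) × ℕ => v q.1 q.2) '' S, μ (statePts R v s ∩ K) := by
  conv_lhs => rw [hS.eq_biUnion, Set.iUnion₂_inter]
  refine measure_biUnion (hcount.mono ?_) ?_ ?_
  · rintro _ ⟨q, hq, rfl⟩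
    exact ⟨q, hS.1 hq, rfl⟩
  · intro s _ t _ hst
    exact Set.disjoint_left.2 fun q hq hq' => hst (hq.1.2.symm.trans hq'.1.2)
  · rintro _ ⟨q, hq, rfl⟩
    exact hmeas q (hS.1 hq)

/-- in a system with a probability assignment for agent `i` that is
concentrated on the current information set (`μ (r,m) (K_i(r,m)) = 1`), and in which
only countably many local states of agent `j` occur, agent `j` maintains probabilistic
total secrecy with respect to `i` iff for every `j`-local set `S` there is a constant
`σ ∈ [0,1]` with `μ (r,m) (S ∩ K_i(r,m)) = σ` for every point `(r,m)`. -/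
theorem probTotalSecrecy_iff_constant_on_jLocal (R : Set (ℕ → G)) (hR : R.Nonempty)
    (vi : (ℕ → G) → ℕ → LI) (vj : (ℕ → G) → ℕ → LJ)
    (MS : (ℕ → G) × ℕ → MeasurableSpace ((ℕ → G) × ℕ))
    (μ : (p : (ℕ → G) × ℕ) → @Measure ((ℕ → G) × ℕ) (MS p))
    (hprob : ∀ p ∈ ptsOf R, IsProbabilityMeasure (μ p))
    (hmeas : ∀ p ∈ ptsOf R, ∀ q ∈ ptsOf R,
      MeasurableSet[MS p] (infoSet R vj q ∩ infoSet R vi p))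
    (hconc : ∀ p ∈ ptsOf R, μ p (infoSet R vi p) = 1)
    (hcount : {s : LJ | ∃ p ∈ ptsOf R, vj p.1 p.2 = s}.Countable) :
    (∀ p ∈ ptsOf R, ∀ p' ∈ ptsOf R, ∀ q ∈ ptsOf R,
        μ p (infoSet R vj q ∩ infoSet R vi p) =
          μ p' (infoSet R vj q ∩ infoSet R vi p')) ↔
      (∀ S : Set ((ℕ → G) × ℕ), IsLocalSet R vj S →
        ∃ σ : ℝ≥0∞, σ ≤ 1 ∧ ∀ p ∈ ptsOf R, μ p (S ∩ infoSet R vi p) = σ) := by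
  constructor
  · intro h S hS
    obtain ⟨r, hr⟩ := hR
    have hr : (r, 0) ∈ ptsOf R := hr
    refine ⟨μ (r, 0) (S ∩ infoSet R vi (r, 0)), ?_, fun p hp => ?_⟩
    · exact (measure_mono Set.inter_subset_right).trans (hconc _ hr).le
    · rw [hS.measure_inter_eq_tsum hcount _ _ (hmeas p hp),
        hS.measure_inter_eq_tsum hcount _ _ (hmeas _ hr)]
      refine tsum_congr ?_
      rintro ⟨_, q, hq, rfl⟩
      exact h p hp _ hr q (hS.1 hq)
  · intro h p hp p' hp' q _
    obtain ⟨σ, _, hσ⟩ := h _ (isLocalSet_infoSet R vj q)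
    exact (hσ p hp).trans (hσ p' hp').symm

end Paper
end

section
/- If R is a system in which agent i has perfect recall and Ω is an arbitrary set of i-information sets, then there exists a subset Ω' ⊆ Ω such that the sets R(K) for K ∈ Ω' are pairwise disjoint and ⋃_{K ∈ Ω'} R(K) = ⋃_{K ∈ Ω} R(K). -/
namespace Paper

variable {G LI : Type*}

/-- `R(U)`: the runs of `R` going through a point of `U`. -/
def runsThrough (R : Set (ℕ → G)) (U : Set ((ℕ → G) × ℕ)) : Set (ℕ → G) :=
  {r | r ∈ R ∧ ∃ m : ℕ, (r, m) ∈ U}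

/-- The local-state sequence of the agent with local-state projection `v` at `(r,m)`. -/
noncomputable def lsSeq {L : Type*} (v : (ℕ → G) → ℕ → L) (r : ℕ → G) (m : ℕ) : List L :=
  letI : DecidableRel fun a b : L => a ≠ b := fun _ _ => Classical.dec _
  ((List.range (m + 1)).map (v r)).destutter (· ≠ ·)

/-- The agent with local-state projection `v` has perfect recall in `R`. -/
def PerfectRecall {L : Type*} (R : Set (ℕ → G)) (v : (ℕ → G) → ℕ → L) : Prop :=
  ∀ p q : (ℕ → G) × ℕ, p ∈ ptsOf R → q ∈ infoSet R v p →
    lsSeq v q.1 q.2 = lsSeq v p.1 p.2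

theorem mem_destutter'_ne {L : Type*} [DecidableRel fun a b : L => a ≠ b] {x : L} (l : List L) :
    ∀ a : L, x ∈ a :: l → x ∈ l.destutter' (· ≠ ·) a := by
  induction l with
  | nil => simp
  | cons b l ih =>
    intro a hx
    rw [List.destutter'_cons]
    split_ifs with hab
    · rcases List.mem_cons.1 hx with rfl | hx
      · exact List.mem_cons_self
      · exact List.mem_cons_of_mem _ (ih b hx)
    · obtain rfl := not_not.1 hab
      exact ih a (by simpa using hx)

theorem mem_lsSeq {L : Type*} (v : (ℕ → G) → ℕ → L) (r : ℕ → G) (m : ℕ) (x : L) :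
    x ∈ lsSeq v r m ↔ ∃ k ≤ m, v r k = x := by
  let : DecidableRel fun a b : L => a ≠ b := fun _ _ => Classical.dec _
  have key : x ∈ lsSeq v r m ↔ x ∈ (List.range (m + 1)).map (v r) := by
    unfold lsSeq
    refine ⟨fun h => (List.destutter_sublist _ _).subset h, fun h => ?_⟩
    cases hl : (List.range (m + 1)).map (v r) with
    | nil => simp [hl] at h
    | cons a l =>
      rw [hl] at h
      exact mem_destutter'_ne l a h
  rw [key]
  simp

theorem PerfectRecall.exists_le_eq {L : Type*} {R : Set (ℕ → G)} {v : (ℕ → G) → ℕ → L}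
    (h : PerfectRecall R v) {p q : (ℕ → G) × ℕ} (hp : p ∈ ptsOf R) (hq : q ∈ infoSet R v p)
    {k : ℕ} (hk : k ≤ q.2) : ∃ j ≤ p.2, v p.1 j = v q.1 k := by
  rw [← mem_lsSeq, ← h p q hp hq, mem_lsSeq]
  exact ⟨k, hk, rfl⟩

theorem infoSet_eq_of_eq {L : Type*} (R : Set (ℕ → G)) {v : (ℕ → G) → ℕ → L}
    {p q : (ℕ → G) × ℕ} (h : v p.1 p.2 = v q.1 q.2) : infoSet R v p = infoSet R v q := by
  simp only [infoSet, h]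

/-- if agent `i` has perfect recall and `Ω` is a set of `i`-information
sets, then there is `Ω' ⊆ Ω` such that the sets `R(K)` for `K ∈ Ω'` are pairwise
disjoint and `⋃_{K ∈ Ω'} R(K) = ⋃_{K ∈ Ω} R(K)`. -/
theorem omega_partition (R : Set (ℕ → G)) (hR : R.Nonempty)
    (vi : (ℕ → G) → ℕ → LI) (hpri : PerfectRecall R vi)
    (Ω : Set (Set ((ℕ → G) × ℕ)))
    (hΩ : ∀ K ∈ Ω, ∃ p ∈ ptsOf R, K = infoSet R vi p) :
    ∃ Ω' ⊆ Ω,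
      (∀ K ∈ Ω', ∀ K' ∈ Ω', K ≠ K' →
        Disjoint (runsThrough R K) (runsThrough R K')) ∧
      (⋃ K ∈ Ω', runsThrough R K) = ⋃ K ∈ Ω, runsThrough R K := by
  have hmem : ∀ K ∈ Ω, ∀ q ∈ K, infoSet R vi q = K := by
    intro K hK q hq
    obtain ⟨p, -, rfl⟩ := hΩ K hK
    exact infoSet_eq_of_eq R hq.2
  refine ⟨{K ∈ Ω | ∀ q ∈ K, ∀ k ≤ q.2, infoSet R vi (q.1, k) ∈ Ω → infoSet R vi (q.1, k) = K},
    fun K hK => hK.1, fun K hK K' hK' hne => ?_, Set.Subset.antisymm ?_ fun r hr => ?_⟩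
  · refine Set.disjoint_left.2 fun r ⟨_, m, hm⟩ ⟨_, m', hm'⟩ => hne ?_
    have e := hmem K hK.1 _ hm
    have e' := hmem K' hK'.1 _ hm'
    rcases le_total m m' with hle | hle
    · exact e.symm.trans (hK'.2 _ hm' m hle (e ▸ hK.1))
    · exact (hK.2 _ hm m' hle (e' ▸ hK'.1)).symm.trans e'
  · exact Set.biUnion_mono (fun K hK => hK.1) fun _ _ => subset_rfl
  · obtain ⟨K, hK, hrR, m₀, hm₀⟩ := Set.mem_iUnion₂.1 hr
    classical
    have hex : ∃ m, infoSet R vi (r, m) ∈ Ω := ⟨m₀, (hmem K hK _ hm₀).symm ▸ hK⟩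
    refine Set.mem_iUnion₂.2 ⟨infoSet R vi (r, Nat.find hex), ⟨Nat.find_spec hex, ?_⟩,
      hrR, Nat.find hex, hrR, rfl⟩
    intro q hq k hk hkΩ
    obtain ⟨j, hj, hjk⟩ := hpri.exists_le_eq (p := (r, Nat.find hex)) hrR hq hk
    have e : infoSet R vi (r, j) = infoSet R vi (q.1, k) := infoSet_eq_of_eq R hjk
    rw [← e, le_antisymm hj (Nat.find_min' hex (e ▸ hkΩ))]

end Paper
end
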